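/- For every m≥4, B(t_m) − B((t_m+2t_{m-1}−t_{m-2}−3)/2) = (m/44)(23t_m−38t_{m-1}−3t_{m-2}) + (1/44)(−65t_m+164t_{m-1}−105t_{m-2}) + 3m/4 − 9/4. -/

import Mathlib

/-- The three-letter alphabet of the Tribonacci word. -/
inductive TLetter : Type
  | a | b | c
deriving DecidableEq

/-- The Tribonacci substitution σ(a)=ab, σ(b)=ac, σ(c)=a. -/
def tsubst : TLetter → List TLetter
  | .a => [.a, .b]
  | .b => [.a, .c]
  | .c => [.a]

/-- `Tword m = σ^m(a)`, the m-th finite Tribonacci word. -/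
def Tword : ℕ → List TLetter
  | 0 => [.a]
  | n + 1 => (Tword n).flatMap tsubst

/-- The prefix 𝕋[1,n] of the Tribonacci word of length n
(each `Tword n` is a prefix of the next and has length ≥ n). -/
def TPrefix (n : ℕ) : List TLetter := (Tword n).take n

/-- A word is a factor of the Tribonacci word 𝕋. -/
def IsFactorT (w : List TLetter) : Prop := ∃ m, w <:+: Tword m

/-- `tribAux i = t_{i-2}`: Tribonacci numbers, shifted so that the index is a natural. -/
def tribAux : ℕ → ℕ
  | 0 => 0
  | 1 => 1
  | 2 => 1
  | n + 3 => tribAux (n + 2) + tribAux (n + 1) + tribAux n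

/-- The Tribonacci numbers `t m` for `m : ℤ`: t₋₂=0, t₋₁=1, t₀=1,
`t m = t (m-1) + t (m-2) + t (m-3)` for m ≥ 1. (Junk value 0 below -2.) -/
def t (m : ℤ) : ℕ := tribAux (m + 2).toNat

/-- Kernel numbers: k₀=0, k₁=k₂=1, `k m = k (m-1) + k (m-2) + k (m-3) - 1` for m ≥ 3. -/
def kAux : ℕ → ℕ
  | 0 => 0
  | 1 => 1
  | 2 => 1
  | n + 3 => kAux (n + 2) + kAux (n + 1) + kAux n - 1

def kker (m : ℤ) : ℕ := kAux m.toNat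

/-- `A n`: the number of distinct nonempty words w with ww a factor of 𝕋[1,n]. -/
noncomputable def A (n : ℕ) : ℕ := Nat.card {w : List TLetter // w ≠ [] ∧ (w ++ w) <:+: TPrefix n}

/-- `B n`: the number of occurrences of squares in 𝕋[1,n], i.e. of pairs (w,i) with
w nonempty, i ≥ 1, ww occurring in 𝕋 at position i and i + 2|w| - 1 ≤ n. -/
noncomputable def B (n : ℕ) : ℕ :=
  Nat.card {p : List TLetter × ℕ // p.1 ≠ [] ∧ 1 ≤ p.2 ∧
    p.2 + 2 * p.1.length - 1 ≤ n ∧ (p.1 ++ p.1) <+: (TPrefix n).drop (p.2 - 1)}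

/-- `C n`: the number of distinct nonempty words w with www a factor of 𝕋[1,n]. -/
noncomputable def C (n : ℕ) : ℕ := Nat.card {w : List TLetter // w ≠ [] ∧ (w ++ w ++ w) <:+: TPrefix n}

/-- `D n`: the number of occurrences of cubes in 𝕋[1,n], i.e. of pairs (w,i) with
w nonempty, i ≥ 1, www occurring in 𝕋 at position i and i + 3|w| - 1 ≤ n. -/
noncomputable def D (n : ℕ) : ℕ :=
  Nat.card {p : List TLetter × ℕ // p.1 ≠ [] ∧ 1 ≤ p.2 ∧
    p.2 + 3 * p.1.length - 1 ≤ n ∧ (p.1 ++ p.1 ++ p.1) <+: (TPrefix n).drop (p.2 - 1)}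

/-- The Tribonacci word as a sequence indexed from `0`. -/
def trib (n : ℕ) : TLetter := (Tword n).getD n .a

/-- The cyclic successor of a letter; it is the last letter of its image under `tsubst`. -/
def TLetter.rot : TLetter → TLetter
  | .a => .b
  | .b => .c
  | .c => .a

lemma TLetter.rot_injective : Function.Injective TLetter.rot := by
  intro x y h
  cases x <;> cases y <;> simp_all [TLetter.rot]

/-- The length of the image under `tsubst` of the prefix of length `n` of the Tribonacci word. -/
def P : ℕ → ℕ
  | 0 => 0
  | n + 1 => P n + (tsubst (trib n)).length

lemma Tword_prefix_succ (n : ℕ) : Tword n <+: Tword (n + 1) := by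
  induction n with
  | zero => exact ⟨[.b], rfl⟩
  | succ n ih =>
    obtain ⟨r, hr⟩ := ih
    refine ⟨r.flatMap tsubst, ?_⟩
    conv_rhs => rw [Tword, ← hr]
    simp [Tword]

lemma Tword_prefix {m n : ℕ} (h : m ≤ n) : Tword m <+: Tword n := by
  induction h with
  | refl => exact List.prefix_rfl
  | step _ ih => exact ih.trans (Tword_prefix_succ _)

lemma length_le_length_flatMap_tsubst (l : List TLetter) :
    l.length ≤ (l.flatMap tsubst).length := by
  induction l with
  | nil => simp
  | cons x l ih =>
    simp only [List.flatMap_cons, List.length_append, List.length_cons]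
    have : 1 ≤ (tsubst x).length := by cases x <;> simp [tsubst]
    omega

lemma Tword_eq_cons (n : ℕ) : ∃ l, Tword n = .a :: l := by
  obtain ⟨r, hr⟩ := Tword_prefix (Nat.zero_le n)
  exact ⟨r, hr.symm⟩

lemma lt_length_Tword (n : ℕ) : n < (Tword n).length := by
  induction n with
  | zero => simp [Tword]
  | succ n ih =>
    obtain ⟨l, hl⟩ := Tword_eq_cons n
    have := length_le_length_flatMap_tsubst l
    rw [hl, List.length_cons] at ih
    rw [Tword, hl, List.flatMap_cons, List.length_append]
    have h2 : (tsubst .a).length = 2 := rfl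
    omega

lemma getElem?_Tword {M i : ℕ} (h : i < (Tword M).length) : (Tword M)[i]? = some (trib i) := by
  have hi := lt_length_Tword i
  have : (Tword i)[i]? = (Tword M)[i]? := by
    rcases le_total i M with hM | hM
    · exact ((List.prefix_iff_getElem?.1 (Tword_prefix hM)) i hi).symm ▸
        List.getElem?_eq_getElem hi
    · exact ((List.prefix_iff_getElem?.1 (Tword_prefix hM)) i h).trans
        (List.getElem?_eq_getElem h).symm
  rw [← this, trib, List.getD_eq_getElem?_getD, List.getElem?_eq_getElem hi]
  rfl

lemma length_flatMap_take (M n : ℕ) (h : n ≤ (Tword M).length) :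
    (((Tword M).take n).flatMap tsubst).length = P n := by
  induction n with
  | zero => simp [P]
  | succ n ih =>
    rw [List.take_add_one, getElem?_Tword (by omega)]
    simp [P, ih (by omega)]

lemma some_trib_P_add (n k : ℕ) (hk : k < (tsubst (trib n)).length) :
    some (trib (P n + k)) = (tsubst (trib n))[k]? := by
  have hn := lt_length_Tword n
  have hx : (Tword n)[n] = trib n := by
    have := getElem?_Tword hn
    rw [List.getElem?_eq_getElem hn] at this
    exact Option.some.inj this
  have hsplit : Tword (n + 1) = ((Tword n).take n).flatMap tsubst ++
      (tsubst (trib n) ++ ((Tword n).drop (n + 1)).flatMap tsubst) := by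
    rw [Tword, ← hx, ← List.flatMap_cons, ← List.drop_eq_getElem_cons hn, ← List.flatMap_append,
      List.take_append_drop]
  have hlen := length_flatMap_take n n hn.le
  have h2 : P n + k < (Tword (n + 1)).length := by
    rw [hsplit]; simp only [List.length_append]; omega
  rw [← getElem?_Tword h2, hsplit, List.getElem?_append_right (by omega), hlen,
    Nat.add_sub_cancel_left, List.getElem?_append_left hk]

lemma trib_zero : trib 0 = .a := rfl

lemma trib_P (n : ℕ) : trib (P n) = .a := by
  have := some_trib_P_add n 0 (by cases trib n <;> simp [tsubst])
  cases h : trib n <;> simp_all [tsubst]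

lemma P_succ_of_eq_c {n : ℕ} (h : trib n = .c) : P (n + 1) = P n + 1 := by simp [P, h, tsubst]

lemma P_succ_of_ne_c {n : ℕ} (h : trib n ≠ .c) : P (n + 1) = P n + 2 := by
  cases h' : trib n <;> simp_all [P, tsubst]

lemma trib_P_add_one (n : ℕ) : trib (P n + 1) = (trib n).rot := by
  by_cases hc : trib n = .c
  · rw [← P_succ_of_eq_c hc, trib_P, hc]; rfl
  · have := some_trib_P_add n 1 (by cases h : trib n <;> simp_all [tsubst])
    cases h : trib n <;> simp_all [tsubst, TLetter.rot]

lemma trib_P_succ_sub_one (n : ℕ) : trib (P (n + 1) - 1) = (trib n).rot := by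
  by_cases hc : trib n = .c
  · rw [P_succ_of_eq_c hc, Nat.add_sub_cancel, trib_P, hc]; rfl
  · rw [P_succ_of_ne_c hc]; exact trib_P_add_one n

lemma P_strictMono : StrictMono P := by
  refine strictMono_nat_of_lt_succ fun n => ?_
  by_cases hc : trib n = .c
  · rw [P_succ_of_eq_c hc]; omega
  · rw [P_succ_of_ne_c hc]; omega

lemma exists_P (n : ℕ) : ∃ u, n = P u ∨ (n = P u + 1 ∧ trib u ≠ .c) := by
  induction n with
  | zero => exact ⟨0, Or.inl rfl⟩
  | succ n ih =>
    obtain ⟨u, h | ⟨h, hc⟩⟩ := ih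
    · by_cases hc : trib u = .c
      · exact ⟨u + 1, Or.inl (by rw [P_succ_of_eq_c hc, h])⟩
      · exact ⟨u, Or.inr ⟨by rw [h], hc⟩⟩
    · exact ⟨u + 1, Or.inl (by rw [P_succ_of_ne_c hc, h])⟩

lemma exists_P_of_eq_a {n : ℕ} (h : trib n = .a) : ∃ u, n = P u := by
  obtain ⟨u, hu | ⟨hu, hc⟩⟩ := exists_P n
  · exact ⟨u, hu⟩
  · rw [hu, trib_P_add_one] at h
    cases h' : trib u <;> simp_all [TLetter.rot]

lemma exists_P_of_ne_a {n : ℕ} (h : trib n ≠ .a) : ∃ u, n = P u + 1 ∧ trib u ≠ .c := by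
  obtain ⟨u, hu | hu⟩ := exists_P n
  · exact absurd (hu ▸ trib_P u) h
  · exact ⟨u, hu⟩

lemma trib_succ_of_ne_a {n : ℕ} (h : trib n ≠ .a) : trib (n + 1) = .a := by
  obtain ⟨u, rfl, hc⟩ := exists_P_of_ne_a h
  rw [add_assoc, ← P_succ_of_ne_c hc, trib_P]

lemma trib_add_two_of_aa {n : ℕ} (h : trib n = .a) (h' : trib (n + 1) = .a) :
    trib (n + 2) = .b := by
  obtain ⟨u, rfl⟩ := exists_P_of_eq_a h
  have hc : trib u = .c := by
    rw [trib_P_add_one] at h'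
    cases hu : trib u <;> simp_all [TLetter.rot]
  have := trib_P_add_one (u + 1)
  rwa [trib_succ_of_ne_a (n := u) (by simp [hc]), P_succ_of_eq_c hc] at this

lemma eq_a_of_trib_eq_succ {n : ℕ} (h : trib n = trib (n + 1)) : trib n = .a := by
  by_contra h'
  exact h' (h.trans (trib_succ_of_ne_a h'))

lemma add_two_add_one_le_P (n : ℕ) : P n + 3 ≤ P (n + 2) := by
  have h1 : P n + 1 ≤ P (n + 1) := P_strictMono (by omega)
  have h2 : P (n + 1) + 1 ≤ P (n + 2) := P_strictMono (by omega)
  by_cases hc : trib n = .c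
  · have : P (n + 2) = P (n + 1) + 2 :=
      P_succ_of_ne_c (by rw [trib_succ_of_ne_a (by simp [hc])]; simp)
    omega
  · have := P_succ_of_ne_c hc
    omega

/-- The length of the `j`-th image of a letter under the Tribonacci substitution. -/
def imageLength (j : ℕ) : TLetter → ℕ
  | .a => tribAux (j + 2)
  | .b => tribAux (j + 1) + tribAux j
  | .c => tribAux (j + 1)

lemma tribAux_add_three (n : ℕ) :
    tribAux (n + 3) = tribAux (n + 2) + tribAux (n + 1) + tribAux n := rfl

lemma iterate_P_succ (j u : ℕ) : P^[j] (u + 1) = P^[j] u + imageLength j (trib u) := by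
  induction j generalizing u with
  | zero => cases h : trib u <;> simp [imageLength, tribAux]
  | succ j ih =>
    rw [Function.iterate_succ_apply, Function.iterate_succ_apply]
    have h1 := ih (P u)
    have h2 := ih (P u + 1)
    rw [trib_P] at h1
    rw [trib_P_add_one] at h2
    have h3 : tribAux (j + 1 + 2) = _ := tribAux_add_three j
    cases h : trib u
    · rw [P_succ_of_ne_c (by simp [h]), show P u + 2 = P u + 1 + 1 from rfl, h2, h1, h]
      simp only [TLetter.rot, imageLength, add_assoc, Nat.reduceAdd] at h3 ⊢; omega
    · rw [P_succ_of_ne_c (by simp [h]), show P u + 2 = P u + 1 + 1 from rfl, h2, h1, h]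
      simp only [TLetter.rot, imageLength, add_assoc, Nat.reduceAdd]
    · rw [P_succ_of_eq_c h, h1]
      simp only [imageLength]

lemma iterate_P_zero (j : ℕ) : P^[j] 0 = 0 := by
  induction j with
  | zero => rfl
  | succ j ih => rwa [Function.iterate_succ_apply]

lemma iterate_P_one (j : ℕ) : P^[j] 1 = tribAux (j + 2) := by
  simpa [iterate_P_zero, trib_zero, imageLength] using iterate_P_succ j 0

lemma iterate_P_strictMono (j : ℕ) : StrictMono P^[j] := P_strictMono.iterate j

lemma tribAux_pos (n : ℕ) : 0 < tribAux (n + 1) := by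
  induction n using Nat.strong_induction_on with
  | _ n ih =>
    match n with
    | 0 => simp [tribAux]
    | 1 => simp [tribAux]
    | n + 2 =>
      have : 0 < tribAux (n + 2) := ih (n + 1) (by omega)
      rw [tribAux_add_three]; omega

lemma tribAux_le_succ (n : ℕ) : tribAux n ≤ tribAux (n + 1) := by
  match n with
  | 0 => simp [tribAux]
  | 1 => simp [tribAux]
  | n + 2 => rw [tribAux_add_three]; omega

lemma imageLength_pos (j : ℕ) (x : TLetter) : 0 < imageLength j x := by
  have h1 := tribAux_pos j
  have h2 := tribAux_pos (j + 1)
  cases x <;> simp only [imageLength] <;> omega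

/-- The map sending the end of a maximal repetition to the end of its image. -/
def endMap (n : ℕ) : ℕ := P n + 1

/-- The common overlap of the `j`-th images of two distinct letters, followed by the word. -/
def overlap (j : ℕ) : ℕ := endMap^[j] 0

lemma overlap_succ (j : ℕ) : overlap (j + 1) = P (overlap j) + 1 := by
  rw [overlap, Function.iterate_succ_apply']; rfl

lemma P_add {x n : ℕ} (h : ∀ i < n, trib (x + i) = trib i) : P (x + n) = P x + P n := by
  induction n with
  | zero => simp [P]
  | succ n ih =>
    have := ih fun i hi => h i (by omega)
    rw [← add_assoc, P, this, h n (by omega), P, add_assoc]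

lemma trib_iterate_P_add (j x i : ℕ) (hi : i < overlap j) : trib (P^[j] x + i) = trib i := by
  induction j generalizing i with
  | zero => exact absurd hi (by simp [overlap])
  | succ j ih =>
    rw [overlap_succ] at hi
    rw [Function.iterate_succ_apply']
    obtain ⟨v, hv⟩ := exists_P i
    have hv' : v ≤ overlap j := by
      rw [← P_strictMono.le_iff_le]; omega
    have hP : P (P^[j] x) + P v = P (P^[j] x + v) :=
      (P_add fun i hi => ih i (by omega)).symm
    rcases hv with rfl | ⟨rfl, -⟩
    · rw [hP, trib_P, trib_P]
    · rw [← add_assoc, hP, trib_P_add_one, trib_P_add_one, ih v]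
      rw [← P_strictMono.lt_iff_lt]; omega

lemma iterate_endMap (j x : ℕ) : endMap^[j] x = P^[j] x + overlap j := by
  induction j with
  | zero => simp [overlap]
  | succ j ih =>
    rw [Function.iterate_succ_apply', ih, endMap, P_add fun i hi => trib_iterate_P_add j x i hi,
      overlap_succ, Function.iterate_succ_apply', add_assoc]

lemma overlap_zero : overlap 0 = 0 := rfl

lemma overlap_succ_eq_add (j : ℕ) : overlap (j + 1) = overlap j + tribAux (j + 2) := by
  rw [overlap, Function.iterate_succ_apply, show endMap 0 = 1 from rfl, iterate_endMap,
    iterate_P_one, add_comm]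

lemma two_mul_overlap (j : ℕ) : 2 * overlap j + 3 + tribAux (j + 2) = tribAux (j + 4) := by
  induction j with
  | zero => simp [overlap, tribAux]
  | succ j ih =>
    rw [overlap_succ_eq_add]
    have h1 := tribAux_add_three (j + 2)
    have h2 := tribAux_add_three (j + 1)
    simp only [add_assoc, Nat.reduceAdd] at *
    omega

/-- `MaxRun s L e`: the set of positions `i` with `trib i = trib (i + L)` has the interval
`[s, e)` as a maximal (possibly empty) interval. -/
structure MaxRun (s L e : ℕ) : Prop where
  le : s ≤ e
  eq_of_mem : ∀ i, s ≤ i → i < e → trib i = trib (i + L)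
  ne_right : trib e ≠ trib (e + L)
  ne_left : ∀ q, s = q + 1 → trib q ≠ trib (q + L)

lemma P_add_of_forall_eq {u d v : ℕ} (huv : u ≤ v)
    (h : ∀ i, u ≤ i → i < v → trib i = trib (i + d)) :
    P (v + d) = P v + (P (u + d) - P u) := by
  have hu : P u ≤ P (u + d) := P_strictMono.monotone (by omega)
  induction v, huv using Nat.le_induction with
  | base => omega
  | succ v hv ih =>
    have := ih fun i hi hi' => h i hi (by omega)
    rw [show v + 1 + d = v + d + 1 by omega, P, P, this, h v hv (by omega)]
    omega

lemma trib_eq_image {u d v i : ℕ} (h : ∀ i, u ≤ i → i < v → trib i = trib (i + d))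
    (hi : P u ≤ i) (hi' : i < P v + 1) :
    trib i = trib (i + (P (u + d) - P u)) := by
  obtain ⟨x, hx⟩ := exists_P i
  have hux : u ≤ x := by
    by_contra! hlt
    have h1 : P (x + 1) ≤ P u := P_strictMono.monotone hlt
    rcases hx with rfl | ⟨rfl, hc⟩
    · have := P_strictMono (Nat.lt_add_one x)
      omega
    · rw [P_succ_of_ne_c hc] at h1; omega
  have hxv : x ≤ v := by
    rw [← P_strictMono.le_iff_le]; omega
  have hP := P_add_of_forall_eq hux fun i hi hi' => h i hi (by omega)
  rcases hx with rfl | ⟨rfl, hc⟩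
  · rw [← hP, trib_P, trib_P]
  · have : x < v := by rw [← P_strictMono.lt_iff_lt]; omega
    rw [show P x + 1 + (P (u + d) - P u) = P (x + d) + 1 by omega, trib_P_add_one,
      trib_P_add_one, h x hux this]

lemma MaxRun.image {u d v : ℕ} (h : MaxRun u d v) :
    MaxRun (P u) (P (u + d) - P u) (P v + 1) where
  le := by have := P_strictMono.monotone h.le; omega
  eq_of_mem i hi hi' := trib_eq_image h.eq_of_mem hi hi'
  ne_right := by
    have := P_add_of_forall_eq h.le h.eq_of_mem
    rw [show P v + 1 + (P (u + d) - P u) = P (v + d) + 1 by omega, trib_P_add_one,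
      trib_P_add_one]
    exact TLetter.rot_injective.ne h.ne_right
  ne_left q hq := by
    have hu : P u ≤ P (u + d) := P_strictMono.monotone (by omega)
    obtain ⟨w, rfl⟩ : ∃ w, u = w + 1 := by
      cases u with
      | zero => simp [P] at hq
      | succ w => exact ⟨w, rfl⟩
    rw [show q + (P (w + 1 + d) - P (w + 1)) = P (w + 1 + d) - 1 by omega,
      show q = P (w + 1) - 1 by omega, show w + 1 + d = w + d + 1 by omega,
      trib_P_succ_sub_one, trib_P_succ_sub_one]
    exact TLetter.rot_injective.ne (h.ne_left w rfl)

/-- The Tribonacci word is not eventually periodic. -/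

lemma exists_trib_ne (L : ℕ) (hL : 1 ≤ L) (s : ℕ) : ∃ e, s ≤ e ∧ trib e ≠ trib (e + L) := by
  induction L using Nat.strong_induction_on generalizing s with
  | _ L ih =>
    by_contra! hcon
    obtain ⟨u, hsu, huc⟩ : ∃ u, s ≤ u ∧ trib u ≠ .c := by
      by_cases hc : trib s = .c
      · exact ⟨s + 1, by omega, by rw [trib_succ_of_ne_a (by simp [hc])]; simp⟩
      · exact ⟨s, le_rfl, hc⟩
    have hPu : u ≤ P u := P_strictMono.le_apply
    obtain ⟨y, hy⟩ := exists_P_of_eq_a ((hcon (P u) (by omega)).symm.trans (trib_P u))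
    have huy : u < y := by rw [← P_strictMono.lt_iff_lt]; omega
    have hyL : y + 1 ≤ u + L := by
      have h1 := P_succ_of_ne_c huc
      have h2 := P_strictMono.add_le_nat (m := y - (u + 1)) (n := u + 1)
      rw [show y - (u + 1) + (u + 1) = y by omega] at h2
      omega
    obtain ⟨v, huv, hv, hmin⟩ : ∃ v, u ≤ v ∧ trib v ≠ trib (v + (y - u)) ∧
        ∀ i, u ≤ i → i < v → trib i = trib (i + (y - u)) := by
      have hex := ih (y - u) (by omega) (by omega) u
      classical
      refine ⟨Nat.find hex, (Nat.find_spec hex).1, (Nat.find_spec hex).2, fun i hi hi' => ?_⟩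
      have := Nat.find_min hex hi'
      by_contra hne
      exact this ⟨hi, hne⟩
    have hP := P_add_of_forall_eq huv hmin
    have hle : P u ≤ P v := P_strictMono.monotone huv
    rw [show u + (y - u) = y by omega] at hP
    have := hcon (P v + 1) (by omega)
    rw [show P v + 1 + L = P (v + (y - u)) + 1 by omega, trib_P_add_one, trib_P_add_one] at this
    exact hv (TLetter.rot_injective this)

lemma exists_first_trib_ne (L : ℕ) (hL : 1 ≤ L) (s : ℕ) :
    ∃ e, s ≤ e ∧ (∀ i, s ≤ i → i < e → trib i = trib (i + L)) ∧ trib e ≠ trib (e + L) := by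
  classical
  have hex := exists_trib_ne L hL s
  refine ⟨Nat.find hex, (Nat.find_spec hex).1, fun i hi hi' => ?_, (Nat.find_spec hex).2⟩
  by_contra hne
  exact Nat.find_min hex hi' ⟨hi, hne⟩

lemma exists_last_trib_ne (L q : ℕ) :
    ∃ s, s ≤ q ∧ (∀ i, s ≤ i → i < q → trib i = trib (i + L)) ∧
      ∀ p, s = p + 1 → trib p ≠ trib (p + L) := by
  induction q with
  | zero => exact ⟨0, le_rfl, by omega, by omega⟩
  | succ q ih =>
    by_cases h : trib q = trib (q + L)
    · obtain ⟨s, hs, hs', hs''⟩ := ih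
      refine ⟨s, by omega, fun i hi hi' => ?_, hs''⟩
      rcases Nat.lt_succ_iff_lt_or_eq.1 hi' with h' | rfl
      · exact hs' i hi h'
      · exact h
    · refine ⟨q + 1, le_rfl, by omega, fun p hp => ?_⟩
      obtain rfl : q = p := by omega
      exact h

lemma exists_maxRun (L : ℕ) (hL : 1 ≤ L) (q : ℕ) : ∃ s e, s ≤ q ∧ q ≤ e ∧ MaxRun s L e := by
  obtain ⟨s, hs, hs', hs''⟩ := exists_last_trib_ne L q
  obtain ⟨e, he, he', he''⟩ := exists_first_trib_ne L hL q
  refine ⟨s, e, hs, he, by omega, fun i hi hi' => ?_, he'', hs''⟩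
  rcases lt_or_ge i q with h | h
  · exact hs' i hi h
  · exact he' i h hi'

lemma MaxRun.eq_of_overlap {s L e s' e' q : ℕ} (h : MaxRun s L e) (h' : MaxRun s' L e')
    (hs : s ≤ q) (hq : q < e) (hs' : s' ≤ q) (hq' : q < e') : s = s' ∧ e = e' := by
  constructor
  · rcases lt_trichotomy s s' with hlt | heq | hlt
    · exact absurd (h.eq_of_mem (s' - 1) (by omega) (by omega)) (h'.ne_left _ (by omega))
    · exact heq
    · exact absurd (h'.eq_of_mem (s - 1) (by omega) (by omega)) (h.ne_left _ (by omega))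
  · rcases lt_trichotomy e e' with hlt | heq | hlt
    · exact absurd (h'.eq_of_mem e (by omega) hlt) h.ne_right
    · exact heq
    · exact absurd (h.eq_of_mem e' (by omega) hlt) h'.ne_right

lemma MaxRun.exists_preimage {s L e : ℕ} (h : MaxRun s L e) (hL : 1 ≤ L) (hse : s < e) :
    ∃ u d v, 1 ≤ d ∧ MaxRun u d v ∧ s = P u ∧ s + L = P (u + d) ∧ e = P v + 1 := by
  have hs : trib s = trib (s + L) := h.eq_of_mem s le_rfl hse
  have hsa : trib s = .a := by
    by_contra hne
    obtain ⟨u, rfl, -⟩ := exists_P_of_ne_a hne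
    obtain ⟨y, hy, -⟩ := exists_P_of_ne_a (hs ▸ hne)
    refine h.ne_left (P u) rfl ?_
    rw [show P u + L = P y by omega, trib_P, trib_P]
  obtain ⟨u, rfl⟩ := exists_P_of_eq_a hsa
  obtain ⟨y, hy⟩ := exists_P_of_eq_a (hs ▸ hsa)
  have huy : u < y := by rw [← P_strictMono.lt_iff_lt]; omega
  obtain ⟨d, rfl⟩ := Nat.exists_eq_add_of_lt huy
  rw [add_assoc] at hy
  obtain ⟨v, huv, hv, hv'⟩ := exists_first_trib_ne (d + 1) (by omega) u
  have hrun : MaxRun u (d + 1) v := by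
    refine ⟨huv, hv, hv', fun q hq hne => ?_⟩
    subst hq
    have h0 : P q + 1 ≤ P (q + 1) := P_strictMono (by omega)
    refine h.ne_left (P (q + 1) - 1) (by omega) ?_
    rw [show P (q + 1) - 1 + L = P (q + (d + 1) + 1) - 1 by
      rw [show q + (d + 1) + 1 = q + 1 + (d + 1) by omega]; omega,
      trib_P_succ_sub_one, trib_P_succ_sub_one, hne]
  have himg := hrun.image
  rw [← hy, Nat.add_sub_cancel_left] at himg
  have hle : P u ≤ P v := P_strictMono.monotone huv
  exact ⟨u, d + 1, v, by omega, hrun, rfl, hy,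
    (h.eq_of_overlap himg le_rfl hse le_rfl (by omega)).2⟩

lemma MaxRun.exists_seed {s L e : ℕ} (h : MaxRun s L e) (hL : 1 ≤ L) (he : s + L ≤ e + 1) :
    ∃ j w e₀, MaxRun w 1 e₀ ∧ (j = 0 ∨ trib w ≠ .c) ∧ s = P^[j] w ∧ s + L = P^[j] (w + 1) ∧
      e = endMap^[j] e₀ := by
  induction e using Nat.strong_induction_on generalizing s L with
  | _ e ih =>
    rcases Nat.eq_or_lt_of_le hL with rfl | hL'
    · exact ⟨0, s, e, h, Or.inl rfl, rfl, rfl, rfl⟩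
    obtain ⟨u, d, v, hd, hrun, rfl, hsL, rfl⟩ := h.exists_preimage hL (by omega)
    have hv : v ≤ P v := P_strictMono.le_apply
    have hle : u + d ≤ v + 1 := by
      by_contra! hlt
      have h1 : P (v + 2) ≤ P (u + d) := P_strictMono.monotone hlt
      have h2 := add_two_add_one_le_P v
      omega
    obtain ⟨j, w, e₀, hseed, hc, hu, hud, hve⟩ := ih v (by omega) hrun hd hle
    refine ⟨j + 1, w, e₀, hseed, Or.inr ?_, ?_, ?_, ?_⟩
    · rcases hc with rfl | hc
      · intro hc
        simp only [Function.iterate_zero, id_eq] at hu hud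
        rw [hud, hu, P_succ_of_eq_c hc] at hsL
        omega
      · exact hc
    · rw [Function.iterate_succ_apply', hu]
    · rw [Function.iterate_succ_apply', ← hud, hsL]
    · rw [Function.iterate_succ_apply', ← hve]; rfl

lemma MaxRun.iterate_image {w e : ℕ} (h : MaxRun w 1 e) (j : ℕ) :
    MaxRun (P^[j] w) (imageLength j (trib w)) (endMap^[j] e) := by
  induction j with
  | zero => cases hw : trib w <;> simpa [imageLength, tribAux] using h
  | succ j ih =>
    have := ih.image
    rw [← iterate_P_succ, ← Function.iterate_succ_apply' P, ← Function.iterate_succ_apply' P,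
      iterate_P_succ, Nat.add_sub_cancel_left] at this
    rwa [Function.iterate_succ_apply' endMap]

/-- A square of period `L` starts at (zero-based) position `q` of the Tribonacci word. -/
def IsSquareAt (q L : ℕ) : Prop :=
  1 ≤ L ∧ ∀ i, q ≤ i → i < q + L → trib i = trib (i + L)

/-- The squares starting at `q` whose period is the length of the `j`-th image of the letter at
`w`, with `w` chosen canonically. -/
def Canonical (j w q : ℕ) : Prop :=
  trib w ≠ .c ∧ P^[j] w ≤ q ∧ (trib w = trib (w + 1) → q < P^[j] (w + 1)) ∧
    (trib w ≠ trib (w + 1) → q + imageLength j (trib w) ≤ P^[j] w + overlap j)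

lemma tribAux_le_overlap (j : ℕ) : tribAux (j + 2) ≤ overlap j + 1 := by
  have h := two_mul_overlap j
  have h4 : tribAux (j + 4) = _ := tribAux_add_three (j + 1)
  have h3 := tribAux_add_three j
  match j with
  | 0 => simp [overlap, tribAux]
  | 1 => simp [overlap, tribAux, endMap, P]
  | j + 2 =>
    have h2 : tribAux (j + 2 + 2) = _ := tribAux_add_three (j + 1)
    have h1 : tribAux (j + 2 + 1) = _ := tribAux_add_three j
    have h0 : 0 < tribAux (j + 2) := tribAux_pos (j + 1)
    simp only [add_assoc, Nat.reduceAdd] at *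
    omega

lemma maxRun_one_of_ne {w e : ℕ} (h : MaxRun w 1 e) (hne : trib w ≠ trib (w + 1)) : e = w := by
  by_contra hew
  have := h.le
  exact hne (h.eq_of_mem w le_rfl (by omega))

lemma maxRun_one_of_eq {w e : ℕ} (h : MaxRun w 1 e) (heq : trib w = trib (w + 1)) :
    e = w + 1 := by
  have ha := eq_a_of_trib_eq_succ heq
  have hb := trib_add_two_of_aa ha (heq ▸ ha)
  have h1 := h.le
  rcases lt_trichotomy e (w + 1) with hlt | h2 | hlt
  · obtain rfl : e = w := by omega
    exact absurd heq h.ne_right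
  · exact h2
  · have := h.eq_of_mem (w + 1) (by omega) hlt
    rw [add_assoc, one_add_one_eq_two, hb, ← heq, ha] at this
    exact absurd this (by simp)

lemma Canonical.exists_maxRun {j w q : ℕ} (h : Canonical j w q) :
    ∃ w₀ e₀, MaxRun w₀ 1 e₀ ∧ trib w₀ = trib w ∧ P^[j] w₀ ≤ q ∧
      q + imageLength j (trib w) ≤ endMap^[j] e₀ ∧
      ((w = w₀ ∧ (q < P^[j] (w₀ + 1) ∨ e₀ = w₀)) ∨
        (w = w₀ + 1 ∧ P^[j] (w₀ + 1) ≤ q ∧ e₀ = w₀ + 1)) := by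
  obtain ⟨-, hq, haa, hne⟩ := h
  by_cases heq : trib w = trib (w + 1)
  · have ha := eq_a_of_trib_eq_succ heq
    have hb := trib_add_two_of_aa ha (heq ▸ ha)
    refine ⟨w, w + 1, ⟨by omega, fun i hi hi' => ?_, ?_, ?_⟩, rfl, hq, ?_, Or.inl ⟨rfl, Or.inl
      (haa heq)⟩⟩
    · obtain rfl : i = w := by omega
      exact heq
    · rw [add_assoc, one_add_one_eq_two, hb, ← heq, ha]; simp
    · rintro p rfl hp
      have := trib_add_two_of_aa (hp.trans ha) ha
      rw [show p + 2 = p + 1 + 1 from rfl, ← heq, ha] at this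
      exact absurd this (by simp)
    · have h1 := haa heq
      have h2 := tribAux_le_overlap j
      rw [iterate_endMap, ha]
      simp only [imageLength]
      omega
  · have h1 := hne heq
    by_cases hleft : ∃ p, w = p + 1 ∧ trib p = trib (p + 1)
    · obtain ⟨p, rfl, hp⟩ := hleft
      have ha := eq_a_of_trib_eq_succ hp
      have h2 := iterate_P_strictMono j (Nat.lt_add_one p)
      refine ⟨p, p + 1, ⟨by omega, fun i hi hi' => ?_, heq, ?_⟩, hp, by omega, ?_,
        Or.inr ⟨rfl, hq, rfl⟩⟩
      · obtain rfl : i = p := by omega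
        exact hp
      · rintro p' rfl hp'
        have := trib_add_two_of_aa (hp'.trans ha) ha
        rw [show p' + 2 = p' + 1 + 1 from rfl, ← hp, ha] at this
        exact absurd this (by simp)
      · rwa [iterate_endMap]
    · push Not at hleft
      refine ⟨w, w, ⟨le_rfl, by omega, heq, ?_⟩, rfl, hq, ?_, Or.inl ⟨rfl, Or.inr rfl⟩⟩
      · rintro p rfl
        exact hleft p rfl
      · rwa [iterate_endMap]

lemma Canonical.isSquareAt {j w q : ℕ} (h : Canonical j w q) :
    IsSquareAt q (imageLength j (trib w)) := by
  obtain ⟨w₀, e₀, hrun, hw, hq, hqe, -⟩ := h.exists_maxRun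
  refine ⟨imageLength_pos _ _, fun i hi hi' => ?_⟩
  have := (hrun.iterate_image j).eq_of_mem i (by omega) (by omega)
  rwa [hw] at this

lemma IsSquareAt.exists_canonical {q L : ℕ} (h : IsSquareAt q L) :
    ∃ j w, Canonical j w q ∧ L = imageLength j (trib w) := by
  obtain ⟨hL, hsq⟩ := h
  obtain ⟨s, e, hs, he, hrun⟩ := exists_maxRun L hL q
  have heq : q + L ≤ e := by
    by_contra! hlt
    exact hrun.ne_right (hsq e he hlt)
  obtain ⟨j, w, e₀, hseed, hc, rfl, hsL, rfl⟩ := hrun.exists_seed hL (by omega)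
  rw [iterate_P_succ] at hsL
  obtain rfl : L = imageLength j (trib w) := by omega
  rw [iterate_endMap] at heq
  by_cases hww : trib w = trib (w + 1)
  · have ha := eq_a_of_trib_eq_succ hww
    obtain rfl := maxRun_one_of_eq hseed hww
    by_cases hq : q < P^[j] (w + 1)
    · exact ⟨j, w, ⟨by simp [ha], hs, fun _ => hq, fun h => absurd hww h⟩, rfl⟩
    · refine ⟨j, w + 1, ⟨by simp [← hww, ha], by omega, fun h => ?_, fun _ => ?_⟩, by rw [hww]⟩
      · exact absurd h hseed.ne_right
      · rwa [← hww]
  · obtain rfl := maxRun_one_of_ne hseed hww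
    refine ⟨j, e₀, ⟨?_, hs, fun h => absurd h hww, fun _ => heq⟩, rfl⟩
    rcases hc with rfl | hc
    · exfalso
      have := imageLength_pos 0 (trib e₀)
      simp only [Function.iterate_zero, id_eq, overlap_zero] at heq hs
      omega
    · exact hc

lemma iterate_P_injective {i j w w' : ℕ} (hc : trib w ≠ .c) (hc' : trib w' ≠ .c)
    (h : P^[i] w = P^[j] w') (h' : P^[i] (w + 1) = P^[j] (w' + 1)) : i = j ∧ w = w' := by
  have aux : ∀ {j w w'}, trib w ≠ .c → trib w' ≠ .c → w = P^[j + 1] w' →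
      w + 1 = P^[j + 1] (w' + 1) → False := by
    intro j w w' hc hc' h h'
    rw [Function.iterate_succ_apply'] at h h'
    have hlt : P^[j] w' < P^[j] (w' + 1) := iterate_P_strictMono j (by omega)
    have hy : P^[j] w' + 1 = P^[j] (w' + 1) := by
      by_contra hne
      have := P_strictMono.monotone (show P^[j] w' + 2 ≤ P^[j] (w' + 1) by omega)
      have := add_two_add_one_le_P (P^[j] w')
      omega
    have hyc : trib (P^[j] w') = .c := by
      by_contra hne
      have := P_succ_of_ne_c hne
      rw [hy] at this
      omega
    cases j with
    | zero => exact hc' hyc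
    | succ j =>
      rw [Function.iterate_succ_apply', trib_P] at hyc
      exact absurd hyc (by simp)
  induction i generalizing j with
  | zero =>
    cases j with
    | zero => exact ⟨rfl, h⟩
    | succ j => exact (aux hc hc' h h').elim
  | succ i ih =>
    cases j with
    | zero => exact (aux hc' hc h.symm h'.symm).elim
    | succ j =>
      rw [Function.iterate_succ_apply', Function.iterate_succ_apply'] at h h'
      obtain ⟨rfl, rfl⟩ := ih (P_strictMono.injective h) (P_strictMono.injective h')
      exact ⟨rfl, rfl⟩

lemma Canonical.unique {i j w w' q : ℕ} (h : Canonical i w q) (h' : Canonical j w' q)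
    (hL : imageLength i (trib w) = imageLength j (trib w')) : i = j ∧ w = w' := by
  obtain ⟨w₀, e₀, hrun, hw, hq, hqe, hcase⟩ := h.exists_maxRun
  obtain ⟨w₁, e₁, hrun', hw', hq', hqe', hcase'⟩ := h'.exists_maxRun
  have hi := hrun.iterate_image i
  have hj := hrun'.iterate_image j
  have hpos := imageLength_pos i (trib w)
  rw [hw, hL] at hi
  rw [hw'] at hj
  have hs := (hi.eq_of_overlap hj hq (by omega) hq' (by omega)).1
  obtain ⟨rfl, rfl⟩ := iterate_P_injective (hw ▸ h.1) (hw' ▸ h'.1) hs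
    (by rw [iterate_P_succ, iterate_P_succ, hs, hw, hw', hL])
  refine ⟨rfl, ?_⟩
  have hee : e₀ = e₁ := by
    by_cases hww : trib w₀ = trib (w₀ + 1)
    · rw [maxRun_one_of_eq hrun hww, maxRun_one_of_eq hrun' hww]
    · rw [maxRun_one_of_ne hrun hww, maxRun_one_of_ne hrun' hww]
  omega

lemma getElem?_TPrefix {n k : ℕ} (h : k < n) : (TPrefix n)[k]? = some (trib k) := by
  rw [TPrefix, List.getElem?_take_of_lt h, getElem?_Tword (h.trans (lt_length_Tword n))]

lemma prefix_drop_TPrefix_iff {l : List TLetter} {n q : ℕ} (h : q + l.length ≤ n) :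
    l <+: (TPrefix n).drop q ↔ ∀ k < l.length, l[k]? = some (trib (q + k)) := by
  rw [List.prefix_iff_getElem?]
  refine forall₂_congr fun k hk => ?_
  rw [List.getElem?_drop, getElem?_TPrefix (by omega), List.getElem?_eq_getElem hk]
  exact eq_comm

lemma append_self_prefix_iff {l : List TLetter} {n q : ℕ} (h : q + 2 * l.length ≤ n) :
    l ++ l <+: (TPrefix n).drop q ↔ (∀ k < l.length, l[k]? = some (trib (q + k))) ∧
      ∀ i, q ≤ i → i < q + l.length → trib i = trib (i + l.length) := by
  rw [prefix_drop_TPrefix_iff (by rw [List.length_append]; omega), List.length_append]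
  constructor
  · intro H
    have H1 : ∀ k < l.length, l[k]? = some (trib (q + k)) := fun k hk => by
      rw [← H k (by omega), List.getElem?_append_left hk]
    refine ⟨H1, fun i hi hi' => ?_⟩
    have h2 := H (i - q + l.length) (by omega)
    rw [List.getElem?_append_right (by omega), Nat.add_sub_cancel, H1 _ (by omega)] at h2
    rw [show q + (i - q) = i by omega, show q + (i - q + l.length) = i + l.length by omega] at h2
    exact Option.some.inj h2
  · rintro ⟨H1, H2⟩ k hk
    rcases lt_or_ge k l.length with hlt | hge
    · rw [List.getElem?_append_left hlt, H1 k hlt]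
    · rw [List.getElem?_append_right hge, H1 _ (by omega), H2 _ (by omega) (by omega)]
      congr 2; omega

/-- Start and period of the squares contained in the prefix of length `n`. -/
def squareSet (n : ℕ) : Set (ℕ × ℕ) := {p | IsSquareAt p.1 p.2 ∧ p.1 + 2 * p.2 ≤ n}

lemma squareSet_finite (n : ℕ) : (squareSet n).Finite := by
  refine ((Finset.range (n + 1)) ×ˢ (Finset.range (n + 1))).finite_toSet.subset ?_
  rintro ⟨q, L⟩ ⟨-, h⟩
  simp only [Finset.coe_product, Finset.coe_range, Set.mem_prod, Set.mem_Iio] at h ⊢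
  omega

lemma B_eq_ncard (n : ℕ) : B n = (squareSet n).ncard := by
  rw [B, ← Nat.card_coe_set_eq]
  refine Nat.card_congr (Equiv.ofBijective
    (fun p => ⟨(p.1.2 - 1, p.1.1.length), ?_, ?_⟩) ⟨?_, ?_⟩)
  · obtain ⟨⟨l, i⟩, hl, hi, hn, hp⟩ := p
    have hpos := List.length_pos_iff.2 hl
    have hn' : i + 2 * l.length - 1 ≤ n := hn
    have hi' : 1 ≤ i := hi
    exact ⟨hpos, ((append_self_prefix_iff (l := l) (q := i - 1) (by omega)).1 hp).2⟩
  · obtain ⟨⟨l, i⟩, hl, hi, hn, hp⟩ := p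
    have hn' : i + 2 * l.length - 1 ≤ n := hn
    have hi' : 1 ≤ i := hi
    change i - 1 + 2 * l.length ≤ n
    omega
  · rintro ⟨⟨l, i⟩, hl, hi, hn, hp⟩ ⟨⟨l', i'⟩, hl', hi', hn', hp'⟩ h
    obtain ⟨hq, hlen⟩ : i - 1 = i' - 1 ∧ l.length = l'.length :=
      Prod.mk.inj (congrArg Subtype.val h)
    have hn₁ : i + 2 * l.length - 1 ≤ n := hn
    have hn₂ : i' + 2 * l'.length - 1 ≤ n := hn'
    have hi₁ : 1 ≤ i := hi
    have hi₂ : 1 ≤ i' := hi'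
    have h1 := ((append_self_prefix_iff (l := l) (q := i - 1) (by omega)).1 hp).1
    have h2 := ((append_self_prefix_iff (l := l') (q := i' - 1) (by omega)).1 hp').1
    refine Subtype.ext (Prod.ext (List.ext_getElem? fun k => ?_) (show i = i' by omega))
    change l[k]? = l'[k]?
    rcases lt_or_ge k l.length with hk | hk
    · rw [h1 k hk, h2 k (by omega), hq]
    · rw [List.getElem?_eq_none hk, List.getElem?_eq_none (by omega)]
  · rintro ⟨⟨q, L⟩, hsq, hn⟩
    have hL := hsq.1
    have hlen : ((List.range L).map fun k => trib (q + k)).length = L := by simp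
    refine ⟨⟨((List.range L).map fun k => trib (q + k), q + 1), ?_, by simp, ?_, ?_⟩, ?_⟩
    · rw [← List.length_pos_iff, hlen]; exact hL
    · dsimp only at *; omega
    · refine (append_self_prefix_iff (by simpa using hn)).2 ⟨fun k hk => ?_, ?_⟩
      · rw [hlen] at hk
        simp [List.getElem?_range hk]
      · rw [hlen]; exact hsq.2
    · simp

open Classical in
/-- The number of canonical squares with parameters `j`, `w` ending in `(e, n]`. -/
noncomputable def canonicalCount (e n j w : ℕ) : ℕ :=
  ((Finset.range n).filter fun q => Canonical j w q ∧ e < q + 2 * imageLength j (trib w) ∧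
    q + 2 * imageLength j (trib w) ≤ n).card

lemma Canonical.iterate_P_succ_le {j w q : ℕ} (h : Canonical j w q) :
    P^[j] (w + 1) + imageLength j (trib w) ≤ q + 2 * imageLength j (trib w) := by
  rw [iterate_P_succ]
  have := h.2.1
  omega

lemma iterate_P_le_iterate_P {i j : ℕ} (h : i ≤ j) (x : ℕ) : P^[i] x ≤ P^[j] x := by
  obtain ⟨d, rfl⟩ := Nat.exists_eq_add_of_le h
  rw [Function.iterate_add_apply]
  exact (iterate_P_strictMono i).monotone ((P_strictMono.iterate d).le_apply)

lemma P_two : P 2 = 4 := rfl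

lemma P_one : P 1 = 2 := rfl

lemma tribAux_add_tribAux_lt (j : ℕ) (hj : 2 ≤ j) :
    tribAux (j + 1) + tribAux j < tribAux (j + 2) := by
  obtain ⟨i, rfl⟩ := Nat.exists_eq_add_of_le' hj
  have := tribAux_pos i
  have h : tribAux (i + 2 + 2) = _ := tribAux_add_three (i + 1)
  simp only [add_assoc, Nat.reduceAdd] at *
  omega

lemma Canonical.le_of_window {N j w q : ℕ} (h : Canonical j w q)
    (hlo : endMap^[N + 1] 2 < q + 2 * imageLength j (trib w))
    (hhi : q + 2 * imageLength j (trib w) ≤ P^[N + 1] 4) :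
    j ≤ N ∧ w < P^[N - j + 1] 4 := by
  have hP := h.iterate_P_succ_le
  have hpos := imageLength_pos j (trib w)
  have hj : j ≤ N := by
    by_contra! hlt
    have h4 : P^[N + 1] 4 ≤ P^[j] 4 := iterate_P_le_iterate_P hlt 4
    have hw : w + 1 < 4 := (iterate_P_strictMono j).lt_iff_lt.1 (by omega)
    have hw3 : w < 3 := by omega
    have h2 : P^[N + 1] 4 = P^[N + 2] 2 := by
      rw [Function.iterate_succ_apply (n := N + 1), P_two]
    have h1 : P^[N + 2] 2 = P^[N + 3] 1 := by
      rw [Function.iterate_succ_apply (n := N + 2), P_one]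
    have hs0 : P^[j] 1 = _ := iterate_P_succ j 0
    have hs1 : P^[j] 2 = _ := iterate_P_succ j 1
    have hs2 : P^[j] 3 = _ := iterate_P_succ j 2
    have hs3 : P^[j] 4 = _ := iterate_P_succ j 3
    have e0 : trib 0 = .a := by decide
    have e1 : trib 1 = .b := by decide
    have e2 : trib 2 = .a := by decide
    have e3 : trib 3 = .c := by decide
    rw [iterate_P_zero, e0] at hs0
    rw [e1] at hs1
    rw [e2] at hs2
    rw [e3] at hs3
    simp only [imageLength] at hs0 hs1 hs2 hs3
    obtain rfl | hlt' : j = N + 1 ∨ N + 1 < j := by omega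
    · rw [iterate_endMap] at hlo
      obtain ⟨-, hq, -, hne⟩ := h
      interval_cases w
      · have := hne (by simp [e0, e1])
        rw [iterate_P_zero, e0] at *
        simp only [imageLength, zero_add, Nat.reduceAdd, add_assoc] at *
        omega
      · have := hne (by simp [e1, e2])
        rw [e1] at *
        simp only [imageLength, Nat.reduceAdd, add_assoc] at *
        omega
      · have h5 : tribAux (N + 1 + 2) = _ := tribAux_add_three N
        have := tribAux_pos N
        rw [e2] at *
        simp only [imageLength, Nat.reduceAdd, add_assoc] at *
        omega
    · have h6 : P^[N + 2] 2 ≤ P^[j] 2 := iterate_P_le_iterate_P hlt' 2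
      have hw' : w + 1 < 2 := (iterate_P_strictMono j).lt_iff_lt.1 (by omega)
      obtain rfl : w = 0 := by omega
      have h7 := tribAux_add_tribAux_lt j (by omega)
      rcases Nat.eq_or_lt_of_le hlt' with heq | hlt''
      · rw [e0] at *
        simp only [imageLength, zero_add] at *
        omega
      · have h8 : P^[N + 3] 1 ≤ P^[j] 1 := iterate_P_le_iterate_P hlt'' 1
        rw [zero_add] at *
        omega
  refine ⟨hj, ?_⟩
  rw [show N + 1 = j + (N - j + 1) by omega, Function.iterate_add_apply] at hhi
  have : w + 1 < P^[N - j + 1] 4 := (iterate_P_strictMono j).lt_iff_lt.1 (by omega)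
  omega

lemma B_sub_B_eq_sum (N : ℕ) (hle : endMap^[N + 1] 2 ≤ P^[N + 1] 4) :
    B (P^[N + 1] 4) = B (endMap^[N + 1] 2) + ∑ j ∈ Finset.range (N + 1),
      ∑ w ∈ Finset.range (P^[N - j + 1] 4),
        canonicalCount (endMap^[N + 1] 2) (P^[N + 1] 4) j w := by
  classical
  set e := endMap^[N + 1] 2
  set n := P^[N + 1] 4
  have hsub : squareSet e ⊆ squareSet n := fun p hp => ⟨hp.1, hp.2.trans hle⟩
  rw [B_eq_ncard, B_eq_ncard, ← Set.ncard_sdiff_add_ncard_of_subset hsub (squareSet_finite n),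
    add_comm]
  congr 1
  set I := (Finset.range (N + 1)).sigma fun j => (Finset.range (P^[N - j + 1] 4)).sigma fun w =>
    (Finset.range n).filter fun q => Canonical j w q ∧ e < q + 2 * imageLength j (trib w) ∧
      q + 2 * imageLength j (trib w) ≤ n with hI
  have hcard : I.card = ∑ j ∈ Finset.range (N + 1),
      ∑ w ∈ Finset.range (P^[N - j + 1] 4), canonicalCount e n j w := by
    rw [hI, Finset.card_sigma]
    refine Finset.sum_congr rfl fun j _ => ?_
    rw [Finset.card_sigma]
    rfl
  rw [← hcard, ← Set.ncard_coe_finset]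
  symm
  refine Set.ncard_congr (fun x _ => (x.2.2, imageLength x.1 (trib x.2.1))) ?_ ?_ ?_
  · rintro ⟨j, w, q⟩ hx
    simp only [hI, Finset.mem_coe, Finset.mem_sigma, Finset.mem_filter] at hx
    obtain ⟨-, -, -, hc, hlo, hhi⟩ := hx
    exact ⟨⟨hc.isSquareAt, hhi⟩, fun h => absurd h.2 (by dsimp only; omega)⟩
  · rintro ⟨j, w, q⟩ ⟨j', w', q'⟩ hx hx' heq
    simp only [hI, Finset.mem_coe, Finset.mem_sigma, Finset.mem_filter] at hx hx'
    obtain ⟨rfl, hL⟩ := Prod.mk.inj heq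
    obtain ⟨rfl, rfl⟩ := hx.2.2.2.1.unique hx'.2.2.2.1 hL
    rfl
  · rintro ⟨q, L⟩ ⟨⟨hsq, hn⟩, hne⟩
    obtain ⟨j, w, hc, rfl⟩ := hsq.exists_canonical
    have hlo : e < q + 2 * imageLength j (trib w) := by
      by_contra! hcon
      exact hne ⟨hsq, hcon⟩
    obtain ⟨hj, hw⟩ := hc.le_of_window hlo hn
    have hpos := imageLength_pos j (trib w)
    refine ⟨⟨j, w, q⟩, ?_, rfl⟩
    dsimp only at hn
    simp only [hI, Finset.mem_coe, Finset.mem_sigma, Finset.mem_filter, Finset.mem_range]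
    exact ⟨by omega, hw, by omega, hc, hlo, hn⟩

lemma tribAux_add_tribAux_le (j : ℕ) : tribAux (j + 1) + tribAux j ≤ tribAux (j + 2) ∧
    tribAux (j + 2) ≤ tribAux (j + 1) + 2 * tribAux j := by
  cases j with
  | zero => simp [tribAux]
  | succ j =>
    have := tribAux_add_three j
    have := tribAux_le_succ j
    simp only [add_assoc, Nat.reduceAdd] at *
    omega

lemma overlap_bounds (j : ℕ) : overlap j + 1 ≤ 2 * tribAux (j + 2) ∧
    overlap j + 1 ≤ 2 * (tribAux (j + 1) + tribAux j) ∧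
    overlap j ≤ tribAux (j + 2) + tribAux (j + 1) := by
  have h := two_mul_overlap j
  have h1 := tribAux_add_three (j + 1)
  have h2 := tribAux_add_three j
  have h3 := tribAux_add_tribAux_le j
  have h4 := tribAux_le_succ j
  simp only [add_assoc, Nat.reduceAdd] at *
  omega

/-- The number of canonical squares at level `j` attached to a letter `x` followed by `y`. -/
def fullCount (j : ℕ) : TLetter → TLetter → ℕ
  | .a, .a => tribAux (j + 2)
  | .a, _ => overlap j + 1 - tribAux (j + 2)
  | .b, _ => overlap j + 1 - (tribAux (j + 1) + tribAux j)
  | .c, _ => 0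

lemma imageLength_le_overlap (j : ℕ) (x : TLetter) : imageLength j x ≤ overlap j + 1 := by
  have h1 := tribAux_le_overlap j
  have h2 := tribAux_add_tribAux_le j
  cases x <;> simp only [imageLength] <;> omega

lemma fullCount_of_ne (j : ℕ) {x y : TLetter} (hc : x ≠ .c) (h : x ≠ y) :
    fullCount j x y = overlap j + 1 - imageLength j x := by
  cases x <;> cases y <;> simp_all [fullCount, imageLength]

lemma canonical_iff (j w q : ℕ) : Canonical j w q ↔
    P^[j] w ≤ q ∧ q < P^[j] w + fullCount j (trib w) (trib (w + 1)) := by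
  by_cases hc : trib w = .c
  · simp only [Canonical, hc, fullCount]
    simp
  · have hle := imageLength_le_overlap j (trib w)
    by_cases h : trib w = trib (w + 1)
    · have ha := eq_a_of_trib_eq_succ h
      have := iterate_P_succ j w
      rw [ha] at this
      simp only [Canonical, ← h, ha, fullCount, imageLength] at *
      simp
      omega
    · rw [fullCount_of_ne j hc h]
      simp only [Canonical, h, ne_eq, hc, not_false_eq_true, true_and, true_imp_iff,
        false_imp_iff]
      omega

lemma canonicalCount_eq (e n j w : ℕ) : canonicalCount e n j w =
    min (P^[j] w + fullCount j (trib w) (trib (w + 1))) (n + 1 - 2 * imageLength j (trib w)) -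
      max (P^[j] w) (e + 1 - 2 * imageLength j (trib w)) := by
  have hpos := imageLength_pos j (trib w)
  rw [canonicalCount, ← Nat.card_Ico]
  congr 1
  ext q
  simp only [Finset.mem_filter, Finset.mem_range, Finset.mem_Ico, canonical_iff]
  omega

section Window

variable {j E M w : ℕ}

lemma canonicalCount_eq_zero_of_lt (h : w + 1 < E) :
    canonicalCount (P^[j] E + overlap j) (P^[j] M) j w = 0 := by
  rw [canonicalCount_eq]
  have hE := (iterate_P_strictMono j).monotone h
  have h1 := iterate_P_succ j w
  have h2 := iterate_P_succ j (w + 1)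
  have h3 := imageLength_le_overlap j (trib w)
  by_cases hc : trib w = .c
  · rw [hc, fullCount]; omega
  · by_cases h' : trib w = trib (w + 1)
    · have ha := eq_a_of_trib_eq_succ h'
      rw [← h'] at h2 ⊢
      rw [ha] at h1 h2 h3 ⊢
      simp only [fullCount, imageLength, Nat.succ_eq_add_one] at *
      omega
    · rw [fullCount_of_ne j hc h']
      simp only [Nat.succ_eq_add_one] at *
      omega

lemma canonicalCount_last : canonicalCount (P^[j] E + overlap j) (P^[j] (w + 1)) j w = 0 := by
  rw [canonicalCount_eq]
  have h1 := iterate_P_succ j w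
  have := imageLength_pos j (trib w)
  omega

lemma canonicalCount_first (ha : trib w = .a) (h : trib (w + 1) = .a → w + 4 ≤ M) :
    canonicalCount (P^[j] (w + 1) + overlap j) (P^[j] M) j w +
      (overlap j + 1 - tribAux (j + 2)) = fullCount j (trib w) (trib (w + 1)) := by
  rw [canonicalCount_eq]
  have h1 := iterate_P_succ j w
  have h3 := imageLength_le_overlap j (trib w)
  by_cases h' : trib (w + 1) = .a
  · have hM := (iterate_P_strictMono j).monotone (h h')
    have hb := overlap_bounds j
    have h2 := iterate_P_succ j (w + 1)
    have h4 := iterate_P_succ j (w + 2)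
    have h5 := iterate_P_succ j (w + 3)
    have h6 : trib (w + 3) = .a := by
      have h7 := trib_add_two_of_aa ha h'
      exact trib_succ_of_ne_a (n := w + 2) (by rw [h7]; simp)
    rw [h6] at h5
    rw [ha, h'] at *
    simp only [fullCount, imageLength, add_assoc, Nat.reduceAdd] at *
    omega
  · rw [fullCount_of_ne j (by simp [ha]) (by rw [ha]; exact Ne.symm h')]
    rw [ha] at *
    simp only [imageLength] at *
    omega

lemma canonicalCount_middle (hE : E ≤ w) (hM : w + 3 ≤ M)
    (h : trib w = .a → trib (w + 1) = .a → w + 4 ≤ M) :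
    canonicalCount (P^[j] E + overlap j) (P^[j] M) j w =
      fullCount j (trib w) (trib (w + 1)) := by
  rw [canonicalCount_eq]
  have hE' := (iterate_P_strictMono j).monotone hE
  have hM' := (iterate_P_strictMono j).monotone hM
  have h1 := iterate_P_succ j w
  have h2 := iterate_P_succ j (w + 1)
  have h4 := iterate_P_succ j (w + 2)
  have h3 := imageLength_le_overlap j (trib w)
  have hb := overlap_bounds j
  have hb' := tribAux_add_tribAux_le j
  by_cases hc : trib w = .c
  · rw [hc, fullCount]; omega
  · have hlo : overlap j + 1 ≤ 2 * imageLength j (trib w) := by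
      cases hw : trib w
      · exact hb.1
      · exact hb.2.1
      · exact absurd hw hc
    by_cases h' : trib w = trib (w + 1)
    · have ha := eq_a_of_trib_eq_succ h'
      have h'' := h'.symm.trans ha
      have hM' := (iterate_P_strictMono j).monotone (h ha h'')
      have h5 := iterate_P_succ j (w + 3)
      have h6 : trib (w + 3) = .a := by
        have h7 := trib_add_two_of_aa ha h''
        exact trib_succ_of_ne_a (n := w + 2) (by rw [h7]; simp)
      rw [h6] at h5
      rw [ha] at h1 hlo ⊢
      rw [h''] at h2 ⊢
      simp only [fullCount, imageLength, add_assoc, Nat.reduceAdd] at *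
      omega
    · have key : overlap j ≤ imageLength j (trib (w + 1)) + imageLength j (trib (w + 2)) := by
        have hmin : ∀ x, tribAux (j + 1) ≤ imageLength j x := by
          intro x; cases x <;> simp only [imageLength] <;> omega
        by_cases h6 : trib (w + 1) = .a
        · have := hmin (trib (w + 2))
          rw [h6]
          simp only [imageLength] at *
          omega
        · have h7 : trib (w + 2) = .a := trib_succ_of_ne_a h6
          have := hmin (trib (w + 1))
          rw [h7]
          simp only [imageLength] at *
          omega
      rw [fullCount_of_ne j hc h']
      simp only [add_assoc, Nat.reduceAdd] at *
      omega

lemma canonicalCount_ba (hE : E ≤ w) (hb : trib w = .b) (ha : trib (w + 1) = .a) :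
    canonicalCount (P^[j] E + overlap j) (P^[j] (w + 2)) j w + tribAux (j + 2) +
      (overlap j - tribAux (j + 2)) = fullCount j .b .a + tribAux (j + 2) := by
  rw [canonicalCount_eq]
  have hE' := (iterate_P_strictMono j).monotone hE
  have h1 := iterate_P_succ j w
  have h2 := iterate_P_succ j (w + 1)
  have h3 := imageLength_le_overlap j (trib w)
  have hb1 := overlap_bounds j
  have hb' := tribAux_add_tribAux_le j
  rw [ha, hb] at *
  simp only [fullCount, imageLength, add_assoc, Nat.reduceAdd] at *
  omega

lemma canonicalCount_a_ne_a (ha : trib w = .a) (hn : trib (w + 1) ≠ .a) :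
    canonicalCount (P^[j] E + overlap j) (P^[j] (w + 2)) j w = 0 := by
  rw [canonicalCount_eq, fullCount_of_ne j (by simp [ha]) (by rw [ha]; exact hn.symm)]
  have h1 := iterate_P_succ j w
  have h2 := iterate_P_succ j (w + 1)
  have hb' := tribAux_add_tribAux_le j
  have h4 : imageLength j (trib (w + 1)) ≤ tribAux (j + 1) + tribAux j := by
    cases hx : trib (w + 1) <;> simp_all [imageLength]
  rw [ha] at *
  simp only [imageLength, add_assoc, Nat.reduceAdd] at *
  match j with
  | 0 => simp [overlap, tribAux] at *
  | 1 =>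
    simp [overlap, endMap, P, tribAux] at *
  | j + 2 =>
    have := tribAux_add_tribAux_lt (j + 2) (by omega)
    omega

end Window

lemma sum_Ico_P {R : Type*} [AddCommMonoid R] (h : ℕ → R) {x y : ℕ} (hxy : x ≤ y) :
    ∑ w ∈ Finset.Ico (P x) (P y), h w =
      ∑ v ∈ Finset.Ico x y, ∑ w ∈ Finset.Ico (P v) (P (v + 1)), h w := by
  induction y, hxy using Nat.le_induction with
  | base => simp
  | succ y hxy ih =>
    rw [Finset.sum_Ico_succ_top hxy, ← ih, Finset.sum_Ico_consecutive _
      (P_strictMono.monotone hxy) (P_strictMono.monotone y.le_succ)]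

lemma sum_Ico_P_succ {R : Type*} [AddCommMonoid R] (h : ℕ → R) (v : ℕ) :
    ∑ w ∈ Finset.Ico (P v) (P (v + 1)), h w =
      if trib v = .c then h (P v) else h (P v) + h (P v + 1) := by
  split_ifs with hc
  · rw [P_succ_of_eq_c hc]; simp
  · rw [P_succ_of_ne_c hc, Finset.sum_Ico_succ_top (by omega)]; simp

/-- The number of canonical squares at level `j` attached to the letters of the image of a
letter. -/
def blockCount (j : ℕ) : TLetter → ℕ
  | .a => (overlap j + 1 - tribAux (j + 2)) + (overlap j + 1 - (tribAux (j + 1) + tribAux j))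
  | .b => overlap j + 1 - tribAux (j + 2)
  | .c => tribAux (j + 2)

lemma sum_fullCount (j : ℕ) {x y : ℕ} (hxy : x ≤ y) :
    ∑ w ∈ Finset.Ico (P x) (P y), fullCount j (trib w) (trib (w + 1)) =
      ∑ v ∈ Finset.Ico x y, blockCount j (trib v) := by
  rw [sum_Ico_P _ hxy]
  refine Finset.sum_congr rfl fun v _ => ?_
  rw [sum_Ico_P_succ]
  have h1 := trib_P (v + 1)
  cases h : trib v
  · rw [P_succ_of_ne_c (by simp [h])] at h1
    simp [trib_P, trib_P_add_one, h, TLetter.rot, fullCount, blockCount]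
  · rw [P_succ_of_ne_c (by simp [h])] at h1
    simp [trib_P, trib_P_add_one, h, TLetter.rot, fullCount, blockCount]
  · rw [P_succ_of_eq_c h] at h1
    simp [trib_P, h1, fullCount, blockCount]

lemma sum_letters (g : TLetter → ℤ) (i : ℕ) (hi : ∀ i, endMap^[i] 2 ≤ P^[i] 4) :
    2 * ∑ v ∈ Finset.Ico (endMap^[i] 2) (P^[i] 4), g (trib v) =
      (tribAux i + 2 * tribAux (i + 1) - tribAux (i + 2) + 1) * g .a +
      (tribAux i - 2 * tribAux (i + 1) + tribAux (i + 2) + 1) * g .b +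
      (tribAux (i + 2) - 3 * tribAux i + 1) * g .c := by
  induction i generalizing g with
  | zero =>
    have h : Finset.Ico 2 4 = {2, 3} := rfl
    have h2 : trib 2 = .a := by decide
    have h3 : trib 3 = .c := by decide
    simp [h, h2, h3, tribAux]
    ring
  | succ i ih =>
    have hle := hi i
    have hlt := hi (i + 1)
    rw [Function.iterate_succ_apply', Function.iterate_succ_apply', endMap] at hlt ⊢
    set x := endMap^[i] 2
    set y := P^[i] 4
    have h1 := sum_Ico_P (fun w => g (trib w)) hle
    rw [Finset.sum_eq_sum_Ico_succ_bot (by omega)] at h1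
    have h2 := ih fun l => match l with
      | .a => g .a + g .b
      | .b => g .a + g .c
      | .c => g .a
    have h3 : ∀ v ∈ Finset.Ico x y, ∑ w ∈ Finset.Ico (P v) (P (v + 1)), g (trib w) =
        (fun l => match l with
          | TLetter.a => g .a + g .b
          | .b => g .a + g .c
          | .c => g .a) (trib v) := by
      intro v _
      rw [sum_Ico_P_succ (fun w => g (trib w))]
      cases h : trib v <;> simp [trib_P, trib_P_add_one, h, TLetter.rot]
    rw [Finset.sum_congr rfl h3, trib_P] at h1
    have h4 : (tribAux (i + 1 + 2) : ℤ) = tribAux (i + 2) + tribAux (i + 1) + tribAux i := by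
      rw [← Nat.cast_add, ← Nat.cast_add, ← tribAux_add_three]
    rw [← h1] at h2
    dsimp only at h2
    rw [h4, show i + 1 + 1 = i + 2 from rfl]
    linear_combination h2

lemma window_letters (i : ℕ) : ∃ k, P^[i + 1] 4 = k + 3 ∧ endMap^[i + 1] 2 ≤ k + 1 ∧
    ((i % 3 = 0 ∧ trib (endMap^[i + 1] 2) = .b ∧ trib (k + 1) = .b ∧ trib (k + 2) = .a) ∨
      (i % 3 = 1 ∧ trib (endMap^[i + 1] 2) = .c ∧ endMap^[i + 1] 2 ≤ k ∧
        trib k = .c ∧ trib (k + 1) = .a ∧ trib (k + 2) = .b) ∨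
      (i % 3 = 2 ∧ trib (endMap^[i + 1] 2) = .a ∧ endMap^[i + 1] 2 ≤ k ∧
        trib (k + 1) = .a ∧ trib (k + 2) = .c)) := by
  induction i with
  | zero => exact ⟨4, by decide, by decide, Or.inl ⟨rfl, by decide, by decide, by decide⟩⟩
  | succ i ih =>
    obtain ⟨k, hM, hE, h⟩ := ih
    rw [Function.iterate_succ_apply' (n := i + 1), Function.iterate_succ_apply' (n := i + 1), hM]
    set E := endMap^[i + 1] 2
    have hE' := P_strictMono.monotone hE
    have hk := P_strictMono (Nat.lt_succ_self k)
    rw [Nat.succ_eq_add_one] at hk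
    rcases h with ⟨hi, h0, h1, h2⟩ | ⟨hi, h0, hk', h1, h2, h3⟩ | ⟨hi, h0, hk', h1, h2⟩
    · have e1 := P_succ_of_ne_c (n := k + 1) (by simp [h1])
      have e2 := P_succ_of_ne_c (n := k + 2) (by simp [h2])
      simp only [add_assoc, Nat.reduceAdd] at e1 e2
      refine ⟨P (k + 1) + 1, by omega, by simp only [endMap]; omega, Or.inr <| Or.inl
        ⟨by omega, by simp [endMap, trib_P_add_one, h0, TLetter.rot],
          by simp only [endMap]; omega, by simp [trib_P_add_one, h1, TLetter.rot], ?_, ?_⟩⟩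
      · rw [add_assoc, ← e1, trib_P]
      · rw [show P (k + 1) + 1 + 2 = P (k + 2) + 1 by omega, trib_P_add_one, h2]; rfl
    · have e1 := P_succ_of_ne_c (n := k + 1) (by simp [h2])
      have e2 := P_succ_of_ne_c (n := k + 2) (by simp [h3])
      simp only [add_assoc, Nat.reduceAdd] at e1 e2
      have := P_strictMono.monotone hk'
      refine ⟨P (k + 1) + 1, by omega, by simp only [endMap]; omega, Or.inr <| Or.inr
        ⟨by omega, by simp [endMap, trib_P_add_one, h0, TLetter.rot],
          by simp only [endMap]; omega, ?_, ?_⟩⟩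
      · rw [add_assoc, ← e1, trib_P]
      · rw [show P (k + 1) + 1 + 2 = P (k + 2) + 1 by omega, trib_P_add_one, h3]; rfl
    · have e1 := P_succ_of_ne_c (n := k + 1) (by simp [h1])
      have e2 := P_succ_of_eq_c (n := k + 2) h2
      simp only [add_assoc, Nat.reduceAdd] at e1 e2
      refine ⟨P (k + 1), by omega, by simp only [endMap]; omega, Or.inl
        ⟨by omega, by simp [endMap, trib_P_add_one, h0, TLetter.rot], ?_, ?_⟩⟩
      · rw [trib_P_add_one, h1]; rfl
      · rw [← e1, trib_P]

lemma iterate_endMap_two_le (i : ℕ) : endMap^[i] 2 ≤ P^[i] 4 := by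
  cases i with
  | zero => simp
  | succ i =>
    obtain ⟨k, h1, h2, -⟩ := window_letters i
    omega

/-- The canonical squares lost at the two ends of a window. -/
def edgeCount (i j : ℕ) : ℕ :=
  if i % 3 = 0 then max (overlap j) (tribAux (j + 2))
  else if i % 3 = 1 then
    (overlap j + 1 - tribAux (j + 2)) + (overlap j + 1 - (tribAux (j + 1) + tribAux j))
  else overlap j + 1 - tribAux (j + 2)

lemma sum_canonicalCount_add (i j : ℕ) :
    ∑ w ∈ Finset.range (P^[i + 1] 4),
        canonicalCount (endMap^[i + j + 1] 2) (P^[i + j + 1] 4) j w +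
      (overlap j + 1 - tribAux (j + 2)) + edgeCount i j =
      ∑ v ∈ Finset.Ico (endMap^[i] 2) (P^[i] 4), blockCount j (trib v) := by
  obtain ⟨k, hM, hE, h⟩ := window_letters i
  rw [show i + j + 1 = j + (i + 1) by omega, Function.iterate_add_apply endMap j (i + 1),
    Function.iterate_add_apply P j (i + 1), iterate_endMap,
    ← sum_fullCount j (iterate_endMap_two_le i),
    ← Function.iterate_succ_apply' P, hM]
  have hEx : endMap^[i + 1] 2 = P (endMap^[i] 2) + 1 := Function.iterate_succ_apply' ..
  have hMa : trib (k + 3) = .a := by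
    rw [← hM, Function.iterate_succ_apply' P, trib_P]
  set x := endMap^[i] 2
  set E := endMap^[i + 1] 2
  have ha : trib (P x) = .a := trib_P x
  have hsplit (g : ℕ → ℕ) : ∑ w ∈ Finset.Ico (P x) (k + 3), g w =
      g (P x) + ∑ w ∈ Finset.Ico E (k + 1), g w + g (k + 1) + g (k + 2) := by
    rw [Finset.sum_Ico_succ_top (by omega), Finset.sum_Ico_succ_top (by omega),
      Finset.sum_eq_sum_Ico_succ_bot (by omega), ← hEx]
  rw [Finset.range_eq_Ico, ← Finset.sum_Ico_consecutive _ (Nat.zero_le (P x)) (by omega),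
    Finset.sum_eq_zero fun w hw => canonicalCount_eq_zero_of_lt
      (by have := (Finset.mem_Ico.1 hw).2; omega), zero_add,
    hsplit, hsplit,
    canonicalCount_last (w := k + 2), Finset.sum_congr rfl fun w hw => canonicalCount_middle
      (Finset.mem_Ico.1 hw).1 (by have := (Finset.mem_Ico.1 hw).2; omega) ?_]
  · have hfirst := canonicalCount_first (j := j) (M := k + 3) ha ?_
    · rw [← hEx] at hfirst
      have hmid : canonicalCount (P^[j] E + overlap j) (P^[j] (k + 3)) j (k + 1) +
          edgeCount i j = fullCount j (trib (k + 1)) (trib (k + 1 + 1)) +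
            fullCount j (trib (k + 2)) (trib (k + 2 + 1)) := by
        rcases h with ⟨hi, h0, h1, h2⟩ | ⟨hi, h0, hk', h1, h2, h3⟩ | ⟨hi, h0, hk', h1, h2⟩
        · have := canonicalCount_ba (j := j) hE h1 h2
          simp only [add_assoc, Nat.reduceAdd] at *
          rw [h1, h2, hMa, edgeCount, if_pos hi]
          simp only [fullCount] at *
          omega
        · rw [canonicalCount_a_ne_a (w := k + 1) h2 (by simp [h3]), h2, h3, hMa, edgeCount,
            if_neg (by omega), if_pos hi]
          simp [fullCount]
        · rw [canonicalCount_a_ne_a (w := k + 1) h1 (by simp [h2]), h1, h2, edgeCount,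
            if_neg (by omega), if_neg (by omega)]
          simp [fullCount]
      rw [← hEx]
      omega
    · rw [← hEx]
      intro hEa
      rcases h with h | h | h
      · rw [h.2.1] at hEa; cases hEa
      · rw [h.2.1] at hEa; cases hEa
      · omega
  · intro hw1 hw2
    have hw := (Finset.mem_Ico.1 hw).2
    by_contra! hlt
    obtain rfl : w = k := by omega
    rcases h with ⟨hi, h0, h1, h2⟩ | ⟨hi, h0, hk', h1, h2, h3⟩ | ⟨hi, h0, hk', h1, h2⟩
    · rw [h1] at hw2; cases hw2
    · rw [h1] at hw1; cases hw1
    · have := trib_add_two_of_aa hw1 hw2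
      rw [h2] at this; cases this

lemma edgeCount_add_three (i j : ℕ) : edgeCount (i + 3) j = edgeCount i j := by
  simp [edgeCount]

lemma sum_edgeCount (N : ℕ) :
    ∑ j ∈ Finset.range (N + 1), edgeCount (N - j) j + N + 1 = tribAux (N + 3) := by
  rw [← Finset.sum_flip]
  have hcongr : ∀ N, ∑ r ∈ Finset.range (N + 1), edgeCount (N - (N - r)) (N - r) =
      ∑ r ∈ Finset.range (N + 1), edgeCount r (N - r) := fun N =>
    Finset.sum_congr rfl fun r hr => by
      rw [Nat.sub_sub_self (by have := Finset.mem_range.1 hr; omega)]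
  rw [hcongr]
  induction N using Nat.strong_induction_on with
  | _ N ih =>
    match N with
    | 0 => decide
    | 1 => decide
    | 2 => decide
    | N + 3 =>
      have h := ih N (by omega)
      rw [Finset.sum_range_succ', Finset.sum_range_succ', Finset.sum_range_succ']
      simp only [Nat.reduceAdd, Nat.reduceSubDiff, Nat.sub_zero, zero_add, add_assoc,
        edgeCount_add_three] at *
      rw [show edgeCount 0 (N + 3) = max (overlap (N + 3)) (tribAux (N + 3 + 2)) from rfl,
        show edgeCount 1 (N + 2) = (overlap (N + 2) + 1 - tribAux (N + 2 + 2)) +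
          (overlap (N + 2) + 1 - (tribAux (N + 2 + 1) + tribAux (N + 2))) from rfl,
        show edgeCount 2 (N + 1) = overlap (N + 1) + 1 - tribAux (N + 1 + 2) from rfl]
      have e0 := two_mul_overlap (N + 1)
      have e1 := overlap_succ_eq_add (N + 1)
      have e2 := overlap_succ_eq_add (N + 2)
      have t0 := tribAux_add_three N
      have t1 := tribAux_add_three (N + 1)
      have t2 := tribAux_add_three (N + 2)
      have t3 := tribAux_add_three (N + 3)
      have p0 := tribAux_le_succ N
      have p1 := tribAux_pos N
      have l0 := tribAux_le_overlap (N + 1)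
      have l1 := tribAux_le_overlap (N + 2)
      have l2 : tribAux (N + 3) + tribAux (N + 2) ≤ overlap (N + 2) + 1 :=
        imageLength_le_overlap (N + 2) .b
      have p2 := tribAux_pos (N + 1)
      simp only [add_assoc, Nat.reduceAdd] at *
      omega

lemma cast_tribAux_add_three (n : ℕ) :
    (tribAux (n + 3) : ℚ) = tribAux (n + 2) + tribAux (n + 1) + tribAux n := by
  exact_mod_cast tribAux_add_three n

lemma sum_tribAux (N : ℕ) : 2 * ∑ j ∈ Finset.range (N + 1), (tribAux j : ℚ) =
    tribAux N + tribAux (N + 2) - 1 := by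
  induction N with
  | zero => simp [tribAux]
  | succ N ih =>
    rw [Finset.sum_range_succ, mul_add, ih, cast_tribAux_add_three]
    ring

lemma sum_tribAux_add (N z : ℕ) : ∑ j ∈ Finset.range (N + 1), (tribAux (j + (z + 1)) : ℚ) =
    ∑ j ∈ Finset.range (N + 1), (tribAux (j + z) : ℚ) + tribAux (N + 1 + z) - tribAux z := by
  have h := Finset.sum_range_succ' (fun j => (tribAux (j + z) : ℚ)) (N + 1)
  rw [Finset.sum_range_succ] at h
  rw [zero_add] at h
  simp only [add_right_comm _ 1 z, add_assoc] at h ⊢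
  linarith

/-- Convolution of two shifted Tribonacci sequences. -/
def convSum (y z N : ℕ) : ℚ :=
  ∑ j ∈ Finset.range (N + 1), (tribAux (N - j + y) : ℚ) * tribAux (j + z)

lemma convSum_succ (y z N : ℕ) : convSum y z (N + 1) =
    convSum y (z + 1) N + tribAux (N + 1 + y) * tribAux z := by
  rw [convSum, Finset.sum_range_succ', convSum]
  simp [add_assoc, add_comm 1 z]

lemma convSum_three (y N : ℕ) : convSum y 3 N = convSum y 2 N + convSum y 1 N + convSum y 0 N := by
  simp only [convSum, ← Finset.sum_add_distrib, ← mul_add]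
  refine Finset.sum_congr rfl fun j _ => ?_
  rw [cast_tribAux_add_three, add_zero]

lemma convSum_closed_zero (N : ℕ) :
    44 * convSum 0 0 N = N * ((-8) * tribAux N + (-6) * tribAux (N + 1) + 10 * tribAux (N + 2)) +
      ((-16) * tribAux N + (-10) * tribAux (N + 1) + 10 * tribAux (N + 2)) ∧
    44 * convSum 0 1 N = N * (10 * tribAux N + 2 * tribAux (N + 1) + 4 * tribAux (N + 2)) +
      (20 * tribAux N + (-4) * tribAux (N + 1) + 4 * tribAux (N + 2)) ∧
    44 * convSum 0 2 N = N * (4 * tribAux N + 14 * tribAux (N + 1) + 6 * tribAux (N + 2)) +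
      (8 * tribAux N + (-6) * tribAux (N + 1) + 6 * tribAux (N + 2)) := by
  induction N with
  | zero => simp [convSum, tribAux]
  | succ N ih =>
    obtain ⟨h0, h1, h2⟩ := ih
    rw [convSum_succ, convSum_succ, convSum_succ, convSum_three, zero_add, add_assoc N 1 1,
      add_assoc N 1 2, cast_tribAux_add_three N]
    simp only [tribAux, Nat.cast_zero, Nat.cast_one, mul_zero, mul_one, add_zero, Nat.reduceAdd]
    push_cast
    exact ⟨by linear_combination h1, by linear_combination h2,
      by linear_combination h0 + h1 + h2⟩

lemma convSum_closed_one (N : ℕ) :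
    44 * convSum 1 0 N = N * (10 * tribAux N + 2 * tribAux (N + 1) + 4 * tribAux (N + 2)) +
      (20 * tribAux N + (-4) * tribAux (N + 1) + 4 * tribAux (N + 2)) ∧
    44 * convSum 1 1 N = N * (4 * tribAux N + 14 * tribAux (N + 1) + 6 * tribAux (N + 2)) +
      (8 * tribAux N + 38 * tribAux (N + 1) + 6 * tribAux (N + 2)) ∧
    44 * convSum 1 2 N = N * (6 * tribAux N + 10 * tribAux (N + 1) + 20 * tribAux (N + 2)) +
      (12 * tribAux N + 24 * tribAux (N + 1) + 20 * tribAux (N + 2)) := by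
  induction N with
  | zero => simp [convSum, tribAux]; norm_num
  | succ N ih =>
    obtain ⟨h0, h1, h2⟩ := ih
    rw [convSum_succ, convSum_succ, convSum_succ, convSum_three, zero_add, add_assoc N 1 1,
      add_assoc N 1 2, cast_tribAux_add_three N]
    simp only [add_assoc, tribAux, Nat.cast_zero, Nat.cast_one, mul_zero, mul_one, Nat.reduceAdd]
    push_cast
    exact ⟨by linear_combination h1, by linear_combination h2,
      by linear_combination h0 + h1 + h2⟩

lemma convSum_closed_two (N : ℕ) :
    44 * convSum 2 0 N = N * (4 * tribAux N + 14 * tribAux (N + 1) + 6 * tribAux (N + 2)) +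
      (8 * tribAux N + (-6) * tribAux (N + 1) + 6 * tribAux (N + 2)) ∧
    44 * convSum 2 1 N = N * (6 * tribAux N + 10 * tribAux (N + 1) + 20 * tribAux (N + 2)) +
      (12 * tribAux N + 24 * tribAux (N + 1) + 20 * tribAux (N + 2)) ∧
    44 * convSum 2 2 N = N * (20 * tribAux N + 26 * tribAux (N + 1) + 30 * tribAux (N + 2)) +
      ((-4) * tribAux N + 14 * tribAux (N + 1) + 30 * tribAux (N + 2)) := by
  induction N with
  | zero => simp [convSum, tribAux]; norm_num
  | succ N ih =>
    obtain ⟨h0, h1, h2⟩ := ih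
    rw [convSum_succ, convSum_succ, convSum_succ, convSum_three, zero_add, add_assoc N 1 1,
      add_assoc N 1 2, cast_tribAux_add_three N]
    simp only [tribAux, Nat.cast_zero, Nat.cast_one, mul_zero, mul_one, Nat.reduceAdd]
    push_cast
    exact ⟨by linear_combination h1, by linear_combination h2,
      by linear_combination h0 + h1 + h2⟩

lemma four_mul_sum_canonicalCount (i j : ℕ) :
    4 * (∑ w ∈ Finset.range (P^[i + 1] 4),
        canonicalCount (endMap^[i + j + 1] 2) (P^[i + j + 1] 4) j w : ℚ) + 4 * edgeCount i j =
      2 * (tribAux i + 2 * tribAux (i + 1) - tribAux (i + 2) + 1) * (tribAux (j + 1) - 1) +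
      (tribAux i - 2 * tribAux (i + 1) + tribAux (i + 2) - 1) *
        (tribAux j + 2 * tribAux (j + 1) - tribAux (j + 2) - 1) +
      2 * (tribAux (i + 2) - 3 * tribAux i + 1) * tribAux (j + 2) := by
  have h := sum_canonicalCount_add i j
  have h2 := sum_letters (fun l => (blockCount j l : ℤ)) i iterate_endMap_two_le
  have hQ := congrArg (Int.cast : ℤ → ℚ) h2
  have ho := two_mul_overlap j
  have h3 := tribAux_add_three (j + 1)
  have h4 := tribAux_add_three j
  simp only [add_assoc, Nat.reduceAdd] at h3
  have hoQ : 2 * (overlap j : ℚ) + 3 = tribAux j + 2 * tribAux (j + 1) + tribAux (j + 2) := by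
    exact_mod_cast (by omega :
      2 * overlap j + 3 = tribAux j + 2 * tribAux (j + 1) + tribAux (j + 2))
  have ha := tribAux_le_overlap j
  have hb : tribAux (j + 1) + tribAux j ≤ overlap j + 1 := imageLength_le_overlap j .b
  have hsum := congrArg (Nat.cast : ℕ → ℚ) h
  rw [show blockCount j .a = (overlap j + 1 - tribAux (j + 2)) +
      (overlap j + 1 - (tribAux (j + 1) + tribAux j)) from rfl,
    show blockCount j .b = overlap j + 1 - tribAux (j + 2) from rfl,
    show blockCount j .c = tribAux (j + 2) from rfl] at hQ
  push_cast [Nat.cast_sub ha, Nat.cast_sub hb] at hQ hsum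
  linear_combination 4 * hsum + 2 * hQ +
    (3 * tribAux i + 2 * tribAux (i + 1) - tribAux (i + 2) + 1 : ℚ) * hoQ

lemma sum_convolution (N : ℕ) : ∑ j ∈ Finset.range (N + 1),
      (2 * (tribAux (N - j) + 2 * tribAux (N - j + 1) - tribAux (N - j + 2) + 1) *
        (tribAux (j + 1) - 1) +
      (tribAux (N - j) - 2 * tribAux (N - j + 1) + tribAux (N - j + 2) - 1) *
        (tribAux j + 2 * tribAux (j + 1) - tribAux (j + 2) - 1) +
      2 * (tribAux (N - j + 2) - 3 * tribAux (N - j) + 1) * tribAux (j + 2) : ℚ) =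
    convSum 0 0 N + 4 * convSum 0 1 N - 7 * convSum 0 2 N - 2 * convSum 1 0 N +
      2 * convSum 1 2 N + convSum 2 0 N + convSum 2 2 N -
      4 * ∑ j ∈ Finset.range (N + 1), (tribAux j : ℚ) -
      2 * ∑ j ∈ Finset.range (N + 1), (tribAux (j + 1) : ℚ) +
      4 * ∑ j ∈ Finset.range (N + 1), (tribAux (j + 2) : ℚ) - (N + 1) := by
  have r0 := Finset.sum_flip (n := N) fun j => (tribAux j : ℚ)
  have r1 := Finset.sum_flip (n := N) fun j => (tribAux (j + 1) : ℚ)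
  have r2 := Finset.sum_flip (n := N) fun j => (tribAux (j + 2) : ℚ)
  have hc : (N + 1 : ℚ) = ∑ j ∈ Finset.range (N + 1), (1 : ℚ) := by simp
  have hsplit : ∀ a b c : ℚ, a - 4 * b - 2 * c = a - 3 * b - 2 * c - b := fun a b c => by ring
  have hsplit' : ∀ a b : ℚ, a + 4 * b = a + b + 3 * b := fun a b => by ring
  rw [hsplit, hsplit', hc]
  nth_rw 1 [← r0, ← r1, ← r2]
  simp only [convSum, Finset.mul_sum, ← Finset.sum_add_distrib, ← Finset.sum_sub_distrib]
  refine Finset.sum_congr rfl fun j _ => ?_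
  simp only [add_zero]
  ring

lemma B_sub_B (N : ℕ) : 44 * ((B (P^[N + 1] 4) : ℚ) - B (endMap^[N + 1] 2)) =
    N * (5 * tribAux N - 10 * tribAux (N + 1) + 13 * tribAux (N + 2)) +
      (-56 * tribAux N - 2 * tribAux (N + 1) + 2 * tribAux (N + 2)) + 33 * N := by
  have hB := congrArg (Nat.cast : ℕ → ℚ) (B_sub_B_eq_sum N (iterate_endMap_two_le _))
  have hE := congrArg (Nat.cast : ℕ → ℚ) (sum_edgeCount N)
  have hS := sum_convolution N
  have hterm : ∀ j ∈ Finset.range (N + 1), _ := fun j hj =>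
    four_mul_sum_canonicalCount (N - j) j
  rw [← Finset.sum_congr rfl hterm, Finset.sum_add_distrib, ← Finset.mul_sum,
    ← Finset.mul_sum] at hS
  have hN : ∀ j ∈ Finset.range (N + 1), (∑ w ∈ Finset.range (P^[N - j + 1] 4),
        canonicalCount (endMap^[N - j + j + 1] 2) (P^[N - j + j + 1] 4) j w : ℚ) =
      ∑ w ∈ Finset.range (P^[N - j + 1] 4),
        (canonicalCount (endMap^[N + 1] 2) (P^[N + 1] 4) j w : ℚ) := fun j hj => by
    rw [Nat.sub_add_cancel (Nat.lt_succ_iff.1 (Finset.mem_range.1 hj))]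
  rw [Finset.sum_congr rfl hN] at hS
  push_cast at hB hE
  have s0 := sum_tribAux N
  have s1 := sum_tribAux_add N 0
  have s2 := sum_tribAux_add N 1
  obtain ⟨x00, x01, x02⟩ := convSum_closed_zero N
  obtain ⟨x10, x11, x12⟩ := convSum_closed_one N
  obtain ⟨x20, x21, x22⟩ := convSum_closed_two N
  rw [cast_tribAux_add_three] at hE
  simp only [add_zero, zero_add, add_assoc, Nat.reduceAdd] at s1 s2
  norm_num [tribAux] at s1 s2
  linear_combination 44 * hB + 11 * hS - 44 * hE +
    (x00 + 4 * x01 - 7 * x02 - 2 * x10 + 2 * x12 + x20 + x22) / 4 + 44 * s2 + 22 * s1 - 11 * s0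

theorem repeated_squares_tail_sum (m : ℤ) (hm : 4 ≤ m) :
    (B (t m) : ℚ) - (B ((t m + 2 * t (m - 1) - t (m - 2) - 3) / 2) : ℚ) =
      (m : ℚ) / 44 * (23 * (t m : ℚ) - 38 * (t (m - 1) : ℚ) - 3 * (t (m - 2) : ℚ)) +
        1 / 44 * (-65 * (t m : ℚ) + 164 * (t (m - 1) : ℚ) - 105 * (t (m - 2) : ℚ)) +
        3 * (m : ℚ) / 4 - 9 / 4 := by
  obtain ⟨N, rfl⟩ : ∃ N : ℕ, m = N + 3 := ⟨(m - 3).toNat, by omega⟩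
  have t0 : t (N + 3) = tribAux (N + 5) := by rw [t]; congr 1
  have t1 : t (N + 3 - 1) = tribAux (N + 4) := by rw [t]; congr 1; omega
  have t2 : t (N + 3 - 2) = tribAux (N + 3) := by rw [t]; congr 1; omega
  have hM : P^[N + 1] 4 = tribAux (N + 5) := by
    rw [show (4 : ℕ) = P^[2] 1 from rfl, ← Function.iterate_add_apply, iterate_P_one]
  have hx : P^[N + 1] 2 = tribAux (N + 4) := by
    rw [show (2 : ℕ) = P^[1] 1 from rfl, ← Function.iterate_add_apply, iterate_P_one]
  have hE : (tribAux (N + 5) + 2 * tribAux (N + 4) - tribAux (N + 3) - 3) / 2 =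
      endMap^[N + 1] 2 := by
    have := two_mul_overlap (N + 1)
    simp only [add_assoc, Nat.reduceAdd] at this
    rw [iterate_endMap, hx]
    omega
  have h := B_sub_B N
  have h3 := cast_tribAux_add_three N
  have h4 := cast_tribAux_add_three (N + 1)
  have h5 := cast_tribAux_add_three (N + 2)
  simp only [add_assoc, Nat.reduceAdd] at h4 h5
  rw [t0, t1, t2, hE, ← hM, eq_div_of_mul_eq (by norm_num) ((mul_comm _ _).trans h), hM, h5, h4, h3]
  push_cast
  ring
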